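/- Let m ≥ 1 and let s_1, …, s_m be finite signed Borel measures on ℝ with compact support such that Co(supp s_k) = Δ for every k, where Δ is a closed bounded interval. Let V ⊂ ℂ be an open neighborhood of Δ and let f_0, …, f_m be holomorphic functions on V. Suppose there is a holomorphic function F on ℂ ∖ Δ which agrees with f_0(z) + Σ_{k=1}^m f_k(z)·ŝ_k(z) for all z ∈ V ∖ Δ and which satisfies F(z) = O(1/z) as z → ∞ (i.e. z·F(z) remains bounded as |z| → ∞). Then for every z ∈ ℂ ∖ Δ one has F(z) = Σ_{k=1}^m ∫ f_k(x) ds_k(x)/(z − x). -/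

import Mathlib

open MeasureTheory Set Polynomial Filter

noncomputable section

/-- A signed Borel measure on `ℝ`, represented by a pair of (nonnegative) measures
(a "positive part" and a "negative part"). -/
structure SignedM where
  pos : MeasureTheory.Measure ℝ
  neg : MeasureTheory.Measure ℝ

namespace SignedM

/-- Integral of a complex-valued function against a signed measure. -/
def cintegral (s : SignedM) (f : ℝ → ℂ) : ℂ :=
  (∫ x, f x ∂s.pos) - ∫ x, f x ∂s.neg

/-- Integral of a real-valued function against a signed measure. -/
def rintegral (s : SignedM) (f : ℝ → ℝ) : ℝ :=
  (∫ x, f x ∂s.pos) - ∫ x, f x ∂s.neg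

/-- The Cauchy transform `ŝ(z) = ∫ ds(x)/(z - x)` at a complex point. -/
def cauchy (s : SignedM) (z : ℂ) : ℂ :=
  s.cintegral fun x => (z - (x : ℂ))⁻¹

/-- The Cauchy transform at a real point (real-valued). -/
def cauchyR (s : SignedM) (x : ℝ) : ℝ :=
  s.rintegral fun t => (x - t)⁻¹

/-- The total variation `|s|` (for the constant-sign representation used here). -/
def mass (s : SignedM) : ℝ :=
  (s.pos Set.univ).toReal + (s.neg Set.univ).toReal

/-- The (topological) support of a nonnegative measure. -/
def msupport (μ : MeasureTheory.Measure ℝ) : Set ℝ :=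
  {x | ∀ U : Set ℝ, IsOpen U → x ∈ U → μ U ≠ 0}

/-- The support of a signed measure. -/
def supp (s : SignedM) : Set ℝ := msupport s.pos ∪ msupport s.neg

/-- The signed measure `g·s` with (real, possibly sign-changing) density `g` w.r.t. `s`. -/
def withDensityR (s : SignedM) (g : ℝ → ℝ) : SignedM where
  pos := s.pos.withDensity (fun x => ENNReal.ofReal (g x)) +
    s.neg.withDensity (fun x => ENNReal.ofReal (-g x))
  neg := s.pos.withDensity (fun x => ENNReal.ofReal (-g x)) +
    s.neg.withDensity (fun x => ENNReal.ofReal (g x))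

/-- The product `⟨a, b⟩`: the measure with density `b̂` with respect to `a`. -/
def nik (a b : SignedM) : SignedM := a.withDensityR b.cauchyR

end SignedM

/-- `s ∈ M(Δ)`: a finite Borel measure with constant sign, whose support is compact and
consists of infinitely many points, `Δ` being the smallest closed interval containing it. -/
structure IsM (s : SignedM) (Δ : Set ℝ) : Prop where
  posFinite : MeasureTheory.IsFiniteMeasure s.pos
  negFinite : MeasureTheory.IsFiniteMeasure s.neg
  constSign : s.pos = 0 ∨ s.neg = 0
  compactSupp : IsCompact s.supp
  infiniteSupp : s.supp.Infinite
  hullEq : Δ = Set.Icc (sInf s.supp) (sSup s.supp)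

/-- A set of reals, viewed inside `ℂ`. -/
def cSet (Δ : Set ℝ) : Set ℂ := (fun x : ℝ => (x : ℂ)) '' Δ

/-- `τ` is the inverse measure of `s`: `1/ŝ(z) = z/|s| + b + τ̂(z)` on `ℂ ∖ Δ`. -/
def IsInverse (s τ : SignedM) (Δ : Set ℝ) : Prop :=
  ∃ b : ℝ, ∀ z : ℂ, z ∉ cSet Δ →
    (s.cauchy z)⁻¹ = z / (s.mass : ℂ) + (b : ℂ) + τ.cauchy z

/-- The iterated products `s_{j,k} = ⟨σ_j, σ_{j+1}, …, σ_k⟩` of a Nikishin system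
(`s_{j,k} = σ_j` when `j ≥ k`). -/
def nikSys (σ : ℕ → SignedM) : ℕ → ℕ → SignedM
  | j, k => if h : j < k then (σ j).nik (nikSys σ (j + 1) k) else σ j
  termination_by j k => k - j
  decreasing_by omega

open scoped Topology

theorem differentiableAt_integral_of_bounded {α : Type*} [MeasurableSpace α] {μ : Measure α}
    [IsFiniteMeasure μ] {φ : ℂ → α → ℂ} {z₀ : ℂ} {r C : ℝ} (hr : 0 < r)
    (hm : ∀ z ∈ Metric.ball z₀ r, AEStronglyMeasurable (φ z) μ)
    (hd : ∀ᵐ x ∂μ, DifferentiableOn ℂ (fun z => φ z x) (Metric.ball z₀ r))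
    (hb : ∀ᵐ x ∂μ, ∀ z ∈ Metric.ball z₀ r, ‖φ z x‖ ≤ C) :
    DifferentiableAt ℂ (fun z => ∫ x, φ z x ∂μ) z₀ := by
  have hz₀ : z₀ ∈ Metric.ball z₀ r := Metric.mem_ball_self hr
  have hball : ∀ z ∈ Metric.ball z₀ (r / 2), Metric.closedBall z (r / 4) ⊆ Metric.ball z₀ r := by
    intro z hz
    apply Metric.closedBall_subset_ball'
    rw [Metric.mem_ball] at hz
    linarith
  have hnhds : Metric.ball z₀ r ∈ 𝓝 z₀ := Metric.ball_mem_nhds z₀ hr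
  refine (hasDerivAt_integral_of_dominated_loc_of_deriv_le
    (F' := fun z x => deriv (fun w => φ w x) z) (bound := fun _ => C / (r / 4))
    (Metric.ball_mem_nhds z₀ (half_pos hr)) ?_ ?_ ?_ ?_ (integrable_const _)
    ?_).2.differentiableAt
  · filter_upwards [hnhds] with z hz using hm z hz
  · exact Integrable.of_bound (hm z₀ hz₀) C (hb.mono fun x hx => hx z₀ hz₀)
  · obtain ⟨u, hu0, hu⟩ : ∃ u : ℕ → ℂ, (∀ n, u n ≠ 0 ∧ z₀ + u n ∈ Metric.ball z₀ r) ∧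
        Tendsto u atTop (𝓝[≠] 0) := by
      refine ⟨fun n => ((r / 2 / (n + 1) : ℝ) : ℂ), fun n => ?_, ?_⟩
      · have h1 : (0 : ℝ) < r / 2 / (n + 1) := by positivity
        have h2 : r / 2 / (n + 1) ≤ r / 2 := div_le_self (by positivity) (by simp)
        refine ⟨Complex.ofReal_ne_zero.2 h1.ne', ?_⟩
        rw [Metric.mem_ball, dist_eq_norm, add_sub_cancel_left, Complex.norm_real,
          Real.norm_of_nonneg h1.le]
        linarith
      · refine tendsto_nhdsWithin_iff.2 ⟨?_, Eventually.of_forall fun n => ?_⟩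
        · have : Tendsto (fun n : ℕ => r / 2 / ((n : ℝ) + 1)) atTop (𝓝 0) :=
            tendsto_const_nhds.div_atTop
              (tendsto_atTop_add_const_right _ _ tendsto_natCast_atTop_atTop)
          exact_mod_cast (Complex.continuous_ofReal.tendsto 0).comp this
        · have h1 : (0 : ℝ) < r / 2 / (n + 1) := by positivity
          exact Complex.ofReal_ne_zero.2 h1.ne'
    refine aestronglyMeasurable_of_tendsto_ae (u := (atTop : Filter ℕ))
      (f := fun n x => (u n)⁻¹ • (φ (z₀ + u n) x - φ z₀ x)) ?_ ?_
    · intro n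
      exact ((hm _ (hu0 n).2).sub (hm _ hz₀)).const_smul (u n)⁻¹
    · filter_upwards [hd] with x hx
      exact ((hx.differentiableAt hnhds).hasDerivAt.tendsto_slope_zero).comp hu
  · filter_upwards [hd, hb] with x hx hx' z hz
    refine Complex.norm_deriv_le_of_forall_mem_sphere_norm_le (by positivity) ?_ ?_
    · refine DifferentiableOn.diffContOnCl ?_
      rw [closure_ball _ (by positivity)]
      exact hx.mono (hball z hz)
    · exact fun w hw => hx' w (hball z hz (Metric.sphere_subset_closedBall hw))
  · filter_upwards [hd] with x hx z hz
    exact (hx.differentiableAt (Metric.isOpen_ball.mem_nhds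
      (Metric.ball_subset_ball (by linarith) hz))).hasDerivAt

theorem isClosed_cSet {K : Set ℝ} (hK : IsCompact K) : IsClosed (cSet K) :=
  (hK.image Complex.continuous_ofReal).isClosed

theorem aestronglyMeasurable_of_continuousOn_of_ae_mem {μ : Measure ℝ} {K : Set ℝ}
    (hK : IsCompact K) (hμ : ∀ᵐ x ∂μ, x ∈ K) {g : ℝ → ℂ} (hg : ContinuousOn g K) :
    AEStronglyMeasurable g μ := by
  rw [← Measure.restrict_eq_self_of_ae_mem hμ]
  exact hg.aestronglyMeasurable hK.measurableSet

theorem integrable_of_continuousOn_of_ae_mem {μ : Measure ℝ} [IsFiniteMeasure μ] {K : Set ℝ}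
    (hK : IsCompact K) (hμ : ∀ᵐ x ∂μ, x ∈ K) {g : ℝ → ℂ} (hg : ContinuousOn g K) :
    Integrable g μ := by
  obtain ⟨C, hC⟩ := hK.exists_bound_of_continuousOn hg
  exact Integrable.of_bound (aestronglyMeasurable_of_continuousOn_of_ae_mem hK hμ hg) C
    (hμ.mono hC)

theorem sub_ofReal_ne_zero {K : Set ℝ} {z : ℂ} (hz : z ∉ cSet K) {x : ℝ} (hx : x ∈ K) :
    z - (x : ℂ) ≠ 0 := fun h => hz ⟨x, hx, (sub_eq_zero.1 h).symm⟩

theorem continuousOn_mul_inv_sub {K : Set ℝ} {g : ℝ → ℂ} (hg : ContinuousOn g K) {z : ℂ}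
    (hz : z ∉ cSet K) : ContinuousOn (fun x : ℝ => g x * (z - (x : ℂ))⁻¹) K :=
  hg.mul (ContinuousOn.inv₀ (by fun_prop) fun _ hx => sub_ofReal_ne_zero hz hx)

theorem differentiableAt_integral_mul_inv_sub {μ : Measure ℝ} [IsFiniteMeasure μ] {K : Set ℝ}
    (hK : IsCompact K) (hμ : ∀ᵐ x ∂μ, x ∈ K) {g : ℝ → ℂ} (hg : ContinuousOn g K) {z₀ : ℂ}
    (hz₀ : z₀ ∉ cSet K) :
    DifferentiableAt ℂ (fun z => ∫ x, g x * (z - (x : ℂ))⁻¹ ∂μ) z₀ := by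
  obtain ⟨C, hC⟩ := hK.exists_bound_of_continuousOn hg
  obtain ⟨r, hr, hball⟩ := Metric.isOpen_iff.1 (isClosed_cSet hK).isOpen_compl z₀ hz₀
  have hsub : Metric.ball z₀ (r / 2) ⊆ Metric.ball z₀ r := Metric.ball_subset_ball (by linarith)
  refine differentiableAt_integral_of_bounded (C := C * (r / 2)⁻¹) (half_pos hr) ?_ ?_ ?_
  · exact fun z hz => aestronglyMeasurable_of_continuousOn_of_ae_mem hK hμ
      (continuousOn_mul_inv_sub hg (hball (hsub hz)))
  · filter_upwards [hμ] with x hx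
    exact (DifferentiableOn.inv (by fun_prop) fun z hz =>
      sub_ofReal_ne_zero (hball (hsub hz)) hx).const_mul _
  · filter_upwards [hμ] with x hx z hz
    have h1 : r ≤ dist (x : ℂ) z₀ := by
      by_contra! h
      exact hball h ⟨x, hx, rfl⟩
    have h2 : r / 2 ≤ ‖z - (x : ℂ)‖ := by
      rw [← dist_eq_norm]
      have := dist_triangle (x : ℂ) z z₀
      rw [dist_comm (x : ℂ) z] at this
      rw [Metric.mem_ball] at hz
      linarith
    rw [norm_mul, norm_inv]
    exact mul_le_mul (hC x hx) (inv_anti₀ (half_pos hr) h2) (by positivity)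
      ((norm_nonneg _).trans (hC x hx))

theorem tendsto_integral_mul_inv_sub_cocompact {μ : Measure ℝ} [IsFiniteMeasure μ] {K : Set ℝ}
    (hK : IsCompact K) (hμ : ∀ᵐ x ∂μ, x ∈ K) {g : ℝ → ℂ} (hg : ContinuousOn g K) :
    Tendsto (fun z : ℂ => ∫ x, g x * (z - (x : ℂ))⁻¹ ∂μ) (cocompact ℂ) (𝓝 0) := by
  obtain ⟨C, hC⟩ := hK.exists_bound_of_continuousOn hg
  obtain ⟨R, hR⟩ := hK.exists_bound_of_continuousOn (f := fun x : ℝ => x) continuousOn_id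
  have hfar : ∀ᶠ z : ℂ in cocompact ℂ, ∀ x ∈ K, 1 ≤ ‖z - (x : ℂ)‖ := by
    filter_upwards [(tendsto_norm_cocompact_atTop (E := ℂ)).eventually_ge_atTop (R + 1)]
      with z hz x hx
    have h1 := norm_sub_norm_le z (x : ℂ)
    have h2 := hR x hx
    rw [Complex.norm_real] at h1
    linarith
  have : (cocompact ℂ).IsCountablyGenerated := by
    rw [← Metric.cobounded_eq_cocompact, ← comap_norm_atTop]
    infer_instance
  have hlim := tendsto_integral_filter_of_dominated_convergence (μ := μ) (l := cocompact ℂ)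
    (F := fun z x => g x * (z - (x : ℂ))⁻¹) (f := fun _ => (0 : ℂ)) (fun _ => C) ?_ ?_
    (integrable_const _) ?_
  · simpa using hlim
  · filter_upwards [hfar] with z hz
    refine aestronglyMeasurable_of_continuousOn_of_ae_mem hK hμ (continuousOn_mul_inv_sub hg ?_)
    rintro ⟨x, hx, rfl⟩
    have := hz x hx
    simp only [sub_self, norm_zero] at this
    linarith
  · filter_upwards [hfar] with z hz
    filter_upwards [hμ] with x hx
    rw [norm_mul, norm_inv]
    exact mul_le_of_le_one_right (norm_nonneg _) (inv_le_one_of_one_le₀ (hz x hx)) |>.trans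
      (hC x hx)
  · refine ae_of_all _ fun x => ?_
    have h1 : Tendsto (fun z : ℂ => z - (x : ℂ)) (cocompact ℂ) (cocompact ℂ) :=
      (Homeomorph.subRight (x : ℂ)).isClosedEmbedding.tendsto_cocompact
    simpa using ((tendsto_inv₀_cobounded (α := ℂ)).comp
      (Metric.cobounded_eq_cocompact (α := ℂ) ▸ h1)).const_mul (g x)

theorem dslope_comm {f : ℂ → ℂ} (z w : ℂ) : dslope f z w = dslope f w z := by
  rcases eq_or_ne z w with rfl | h
  · rfl
  · rw [dslope_of_ne _ h.symm, dslope_of_ne _ h, slope_comm]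

theorem exists_bound_dslope {V : Set ℂ} (hV : IsOpen V) {f : ℂ → ℂ}
    (hf : DifferentiableOn ℂ f V) {L : Set ℂ} (hL : IsCompact L) (hLV : L ⊆ V) {z₀ : ℂ}
    (hz₀ : z₀ ∈ V) :
    ∃ r > 0, Metric.ball z₀ r ⊆ V ∧
      ∃ C, ∀ w ∈ L, ∀ z ∈ Metric.ball z₀ r, ‖dslope f z w‖ ≤ C := by
  obtain ⟨ρ, hρ, hball⟩ := Metric.nhds_basis_closedBall.mem_iff.1 (hV.mem_nhds hz₀)
  obtain ⟨A, hA⟩ := hL.exists_bound_of_continuousOn (hf.continuousOn.mono hLV)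
  obtain ⟨B, hB⟩ := (isCompact_closedBall z₀ ρ).exists_bound_of_continuousOn
    (hf.continuousOn.mono hball)
  obtain ⟨D, hD⟩ := (isCompact_closedBall z₀ ρ).exists_bound_of_continuousOn
    ((hf.deriv hV).continuousOn.mono hball)
  have hsub : Metric.ball z₀ (ρ / 2) ⊆ Metric.closedBall z₀ ρ :=
    Metric.ball_subset_closedBall.trans (Metric.closedBall_subset_closedBall (by linarith))
  refine ⟨ρ / 2, half_pos hρ, hsub.trans hball, max D ((A + B) / (ρ / 2)), fun w hw z hz => ?_⟩
  by_cases hwz : w = z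
  · subst hwz
    rw [dslope_same]
    exact le_max_of_le_left (hD w (hsub hz))
  have hpos : 0 < ‖w - z‖ := norm_pos_iff.2 (sub_ne_zero.2 hwz)
  rw [dslope_of_ne _ hwz, slope_def_field, norm_div]
  by_cases hw' : w ∈ Metric.closedBall z₀ ρ
  · refine le_max_of_le_left ((div_le_iff₀ hpos).2 ?_)
    exact Convex.norm_image_sub_le_of_norm_deriv_le
      (fun x hx => hf.differentiableAt (hV.mem_nhds (hball hx))) hD (convex_closedBall z₀ ρ)
      (hsub hz) hw'
  · refine le_max_of_le_right (div_le_div₀ ?_ ?_ (half_pos hρ) ?_)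
    · exact add_nonneg ((norm_nonneg _).trans (hA w hw)) ((norm_nonneg _).trans (hB z (hsub hz)))
    · exact (norm_sub_le _ _).trans (add_le_add (hA w hw) (hB z (hsub hz)))
    · rw [Metric.mem_closedBall, not_le] at hw'
      rw [Metric.mem_ball] at hz
      have := dist_triangle w z z₀
      rw [← dist_eq_norm]
      linarith

theorem continuousOn_dslope_ofReal {V : Set ℂ} (hV : IsOpen V) {f : ℂ → ℂ}
    (hf : DifferentiableOn ℂ f V) {K : Set ℝ} (hKV : cSet K ⊆ V) {z : ℂ} (hz : z ∈ V) :
    ContinuousOn (fun x : ℝ => dslope f z x) K :=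
  ((continuousOn_dslope (hV.mem_nhds hz)).2
    ⟨hf.continuousOn, hf.differentiableAt (hV.mem_nhds hz)⟩).comp
    Complex.continuous_ofReal.continuousOn fun x hx => hKV ⟨x, hx, rfl⟩

theorem differentiableAt_integral_dslope {μ : Measure ℝ} [IsFiniteMeasure μ] {K : Set ℝ}
    (hK : IsCompact K) (hμ : ∀ᵐ x ∂μ, x ∈ K) {V : Set ℂ} (hV : IsOpen V) (hKV : cSet K ⊆ V)
    {f : ℂ → ℂ} (hf : DifferentiableOn ℂ f V) {z₀ : ℂ} (hz₀ : z₀ ∈ V) :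
    DifferentiableAt ℂ (fun z => ∫ x : ℝ, dslope f z x ∂μ) z₀ := by
  obtain ⟨r, hr, hball, C, hC⟩ :=
    exists_bound_dslope hV hf (hK.image Complex.continuous_ofReal) hKV hz₀
  refine differentiableAt_integral_of_bounded (C := C) hr ?_ ?_ ?_
  · exact fun z hz => aestronglyMeasurable_of_continuousOn_of_ae_mem hK hμ
      (continuousOn_dslope_ofReal hV hf hKV (hball hz))
  · filter_upwards [hμ] with x hx
    simp_rw [dslope_comm _ (x : ℂ)]
    exact ((Complex.differentiableOn_dslope (hV.mem_nhds (hKV ⟨x, hx, rfl⟩))).2 hf).mono hball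
  · filter_upwards [hμ] with x hx z hz using hC x ⟨x, hx, rfl⟩ z hz

theorem integral_dslope_ofReal {μ : Measure ℝ} [IsFiniteMeasure μ] {K : Set ℝ}
    (hK : IsCompact K) (hμ : ∀ᵐ x ∂μ, x ∈ K) {f : ℂ → ℂ} (hf : ContinuousOn f (cSet K)) {z : ℂ}
    (hz : z ∉ cSet K) :
    ∫ x : ℝ, dslope f z x ∂μ =
      f z * (∫ x : ℝ, (z - (x : ℂ))⁻¹ ∂μ) - ∫ x : ℝ, f x * (z - (x : ℂ))⁻¹ ∂μ := by
  have hf' : ContinuousOn (fun x : ℝ => f x) K :=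
    hf.comp Complex.continuous_ofReal.continuousOn fun x hx => ⟨x, hx, rfl⟩
  rw [← integral_const_mul, ← integral_sub
    (integrable_of_continuousOn_of_ae_mem hK hμ (continuousOn_mul_inv_sub continuousOn_const hz))
    (integrable_of_continuousOn_of_ae_mem hK hμ (continuousOn_mul_inv_sub hf' hz))]
  refine integral_congr_ae (hμ.mono fun x hx => ?_)
  have h := sub_ofReal_ne_zero hz hx
  have hne : (x : ℂ) ≠ z := fun h' => h (by rw [h', sub_self])
  have h' : (x : ℂ) - z ≠ 0 := sub_ne_zero.2 hne
  simp only [dslope_of_ne _ hne, slope_def_field]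
  field_simp
  ring

theorem ae_mem_of_msupport_subset {μ : Measure ℝ} {K : Set ℝ} (h : SignedM.msupport μ ⊆ K) :
    ∀ᵐ x ∂μ, x ∈ K := by
  filter_upwards [Measure.support_mem_ae (μ := μ)] with x hx
  exact h fun U hU hxU => ((Measure.mem_support_iff_forall x).1 hx U (hU.mem_nhds hxU)).ne'

/-- If `F` is holomorphic on `ℂ ∖ Δ`, agrees near `Δ` with
`f₀ + Σ_{k=1}^m f_k·ŝ_k` and is `O(1/z)` at infinity, then
`F(z) = Σ_k ∫ f_k(x) ds_k(x)/(z − x)` on `ℂ ∖ Δ`. -/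
theorem stmt1
    (m : ℕ) (hm : 1 ≤ m)
    (s : ℕ → SignedM) (Δ : Set ℝ)
    (hfin : ∀ k, 1 ≤ k → k ≤ m →
      MeasureTheory.IsFiniteMeasure (s k).pos ∧ MeasureTheory.IsFiniteMeasure (s k).neg)
    (hsupp : ∀ k, 1 ≤ k → k ≤ m → IsCompact (s k).supp ∧ (s k).supp.Nonempty ∧
      Δ = Set.Icc (sInf (s k).supp) (sSup (s k).supp))
    (V : Set ℂ) (hV : IsOpen V) (hΔV : cSet Δ ⊆ V)
    (f : ℕ → ℂ → ℂ) (hf : ∀ k ≤ m, DifferentiableOn ℂ (f k) V)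
    (F : ℂ → ℂ) (hF : DifferentiableOn ℂ F (cSet Δ)ᶜ)
    (hagree : ∀ z ∈ V \ cSet Δ,
      F z = f 0 z + ∑ k ∈ Finset.Icc 1 m, f k z * (s k).cauchy z)
    (hO : ∃ C R : ℝ, ∀ z : ℂ, R ≤ ‖z‖ → ‖z * F z‖ ≤ C) :
    ∀ z : ℂ, z ∉ cSet Δ →
      F z = ∑ k ∈ Finset.Icc 1 m,
        (s k).cintegral (fun x => f k (x : ℂ) * (z - (x : ℂ))⁻¹) := by
  intro z₁ hz₁
  have hΔ : IsCompact Δ := by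
    rw [(hsupp 1 le_rfl hm).2.2]
    exact isCompact_Icc
  have hae : ∀ k ∈ Finset.Icc 1 m,
      (∀ᵐ x ∂(s k).pos, x ∈ Δ) ∧ (∀ᵐ x ∂(s k).neg, x ∈ Δ) := by
    intro k hk
    obtain ⟨h1, h2⟩ := Finset.mem_Icc.1 hk
    obtain ⟨hc, -, he⟩ := hsupp k h1 h2
    have hs : (s k).supp ⊆ Δ := by
      rw [he]
      exact fun x hx => ⟨csInf_le hc.bddBelow hx, le_csSup hc.bddAbove hx⟩
    exact ⟨ae_mem_of_msupport_subset (subset_union_left.trans hs),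
      ae_mem_of_msupport_subset (subset_union_right.trans hs)⟩
  have hfin' : ∀ k ∈ Finset.Icc 1 m,
      IsFiniteMeasure (s k).pos ∧ IsFiniteMeasure (s k).neg := fun k hk =>
    hfin k (Finset.mem_Icc.1 hk).1 (Finset.mem_Icc.1 hk).2
  have hfk : ∀ k ∈ Finset.Icc 1 m, DifferentiableOn ℂ (f k) V := fun k hk =>
    hf k (Finset.mem_Icc.1 hk).2
  have hfc : ∀ k ∈ Finset.Icc 1 m, ContinuousOn (fun x : ℝ => f k x) Δ := fun k hk =>
    (hfk k hk).continuousOn.comp Complex.continuous_ofReal.continuousOn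
      fun x hx => hΔV ⟨x, hx, rfl⟩
  have hclosed := isClosed_cSet hΔ
  set G : ℂ → ℂ := fun z => ∑ k ∈ Finset.Icc 1 m,
    (s k).cintegral (fun x => f k (x : ℂ) * (z - (x : ℂ))⁻¹) with hG
  set E : ℂ → ℂ := fun z => f 0 z + ∑ k ∈ Finset.Icc 1 m,
    (s k).cintegral (fun x => dslope (f k) z x) with hE
  have hGd : ∀ z ∉ cSet Δ, DifferentiableAt ℂ G z := by
    intro z hz
    refine DifferentiableAt.fun_sum fun k hk => ?_
    have := (hfin' k hk).1
    have := (hfin' k hk).2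
    exact (differentiableAt_integral_mul_inv_sub hΔ (hae k hk).1 (hfc k hk) hz).sub
      (differentiableAt_integral_mul_inv_sub hΔ (hae k hk).2 (hfc k hk) hz)
  have hEd : ∀ z ∈ V, DifferentiableAt ℂ E z := by
    intro z hz
    refine ((hf 0 (Nat.zero_le _)).differentiableAt (hV.mem_nhds hz)).add
      (DifferentiableAt.fun_sum fun k hk => ?_)
    have := (hfin' k hk).1
    have := (hfin' k hk).2
    exact (differentiableAt_integral_dslope hΔ (hae k hk).1 hV hΔV (hfk k hk) hz).sub
      (differentiableAt_integral_dslope hΔ (hae k hk).2 hV hΔV (hfk k hk) hz)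
  have hGt : Tendsto G (cocompact ℂ) (𝓝 0) := by
    rw [← Finset.sum_const_zero (s := Finset.Icc 1 m)]
    refine tendsto_finsetSum _ fun k hk => ?_
    have := (hfin' k hk).1
    have := (hfin' k hk).2
    rw [← sub_self (0 : ℂ)]
    exact (tendsto_integral_mul_inv_sub_cocompact hΔ (hae k hk).1 (hfc k hk)).sub
      (tendsto_integral_mul_inv_sub_cocompact hΔ (hae k hk).2 (hfc k hk))
  have hFt : Tendsto F (cocompact ℂ) (𝓝 0) := by
    obtain ⟨C, R, hCR⟩ := hO
    have hn := tendsto_norm_cocompact_atTop (E := ℂ)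
    refine squeeze_zero_norm' ?_ ((tendsto_const_nhds (x := C)).div_atTop hn)
    filter_upwards [hn.eventually_ge_atTop R, hn.eventually_gt_atTop 0] with z h1 h2
    rw [le_div_iff₀ h2, mul_comm, ← norm_mul]
    exact hCR z h1
  have hEeq : ∀ z ∈ V \ cSet Δ, E z = F z - G z := by
    intro z hz
    rw [hagree z hz, hE, hG, add_sub_assoc, ← Finset.sum_sub_distrib]
    refine congrArg (f 0 z + ·) (Finset.sum_congr rfl fun k hk => ?_)
    have := (hfin' k hk).1
    have := (hfin' k hk).2
    have hc := (hfk k hk).continuousOn.mono hΔV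
    simp only [SignedM.cauchy, SignedM.cintegral]
    rw [integral_dslope_ofReal hΔ (hae k hk).1 hc hz.2,
      integral_dslope_ofReal hΔ (hae k hk).2 hc hz.2]
    ring
  classical
  set H : ℂ → ℂ := fun z => if z ∈ cSet Δ then E z else F z - G z with hH
  have hHd : Differentiable ℂ H := by
    intro z
    by_cases hz : z ∈ cSet Δ
    · refine (hEd z (hΔV hz)).congr_of_eventuallyEq ?_
      filter_upwards [hV.mem_nhds (hΔV hz)] with w hw
      by_cases hw' : w ∈ cSet Δ
      · simp [hH, hw']
      · simp [hH, hw', hEeq w ⟨hw, hw'⟩]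
    · have hnhds := hclosed.isOpen_compl.mem_nhds hz
      refine ((hF.differentiableAt hnhds).sub (hGd z hz)).congr_of_eventuallyEq ?_
      filter_upwards [hnhds] with w hw
      exact if_neg hw
  have hHt : Tendsto H (cocompact ℂ) (𝓝 0) := by
    have h0 := hFt.sub hGt
    rw [sub_zero] at h0
    refine h0.congr' ?_
    filter_upwards [(hΔ.image Complex.continuous_ofReal).compl_mem_cocompact] with z hz
    exact (if_neg hz).symm
  have hzero := hHd.apply_eq_of_tendsto_cocompact z₁ hHt
  rw [hH] at hzero
  simp only [if_neg hz₁] at hzero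
  exact sub_eq_zero.1 hzero
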